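/- For every C > 1 there exists a function V : ℝ → ℝ, twice continuously differentiable, such that: V is even; 0 < V(ξ) < C for all ξ; V is strictly decreasing on (0, ∞); V(ξ) → 0 and V'(ξ) → 0 as ξ → +∞; and V satisfies the solitary-wave profile equation C V''(ξ) = C V(ξ) − V(ξ)/(C − V(ξ)) − (1/2) V(ξ)² for all ξ ∈ ℝ. Moreover V is unique: any other function with all of these properties equals V. -/

import Mathlib

open Filter

/-- The potential. -/
noncomputable def asF (C v : ℝ) : ℝ := C * v ^ 2 / 2 - v ^ 3 / 6 + v + C * Real.log (1 - v / C)

/-- The force. -/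
noncomputable def asf (C v : ℝ) : ℝ := C * v - v / (C - v) - (1 / 2) * v ^ 2

lemma asF_hasDerivAt {C v : ℝ} (hC : 1 < C) (hv : v < C) : HasDerivAt (asF C) (asf C v) v := by
  have hC0 : C ≠ 0 := by positivity
  have h1 : 1 - v / C ≠ 0 := by
    have : v / C < 1 := by rw [div_lt_one (by linarith)]; exact hv
    linarith
  have h2 : C - v ≠ 0 := by linarith
  have hl : HasDerivAt (fun v : ℝ => 1 - v / C) (-(1 / C)) v :=
    ((hasDerivAt_id v).div_const C).const_sub 1
  have := (((((hasDerivAt_pow 2 v).const_mul C).div_const 2).sub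
    ((hasDerivAt_pow 3 v).div_const 6)).add (hasDerivAt_id v)).add ((hl.log h1).const_mul C)
  refine this.congr_deriv ?_
  unfold asf
  have h3 : -(1 / C) / (1 - v / C) = - (1 / (C - v)) := by
    field_simp
  rw [h3]
  field_simp
  push_cast
  ring

lemma asF_le {C v : ℝ} (hC : 1 < C) (h0 : 0 ≤ v) (hv : v < C) : asF C v ≤ C * v ^ 2 / 2 := by
  have h1 : 0 < 1 - v / C := by
    have : v / C < 1 := by rw [div_lt_one (by linarith)]; exact hv
    linarith
  have := Real.log_le_sub_one_of_pos h1
  have h2 : C * Real.log (1 - v / C) ≤ C * (- (v / C)) := by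
    apply mul_le_mul_of_nonneg_left _ (by linarith)
    linarith
  have h3 : C * (- (v / C)) = - v := by field_simp
  have : 0 ≤ v ^ 3 := by positivity
  unfold asF
  linarith

lemma asF_zero (C : ℝ) : asF C 0 = 0 := by simp [asF]

lemma asf_eq (C v : ℝ) : asf C v = v * (C - 1 / (C - v) - v / 2) := by
  unfold asf; ring

lemma as_g_anti {C a b : ℝ} (hab : a < b) (hb : b < C) :
    (C - 1 / (C - b) - b / 2) < (C - 1 / (C - a) - a / 2) := by
  have : 1 / (C - a) < 1 / (C - b) := one_div_lt_one_div_of_lt (by linarith) (by linarith)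
  linarith

lemma as_exists_vs {C : ℝ} (hC : 1 < C) : ∃ vs : ℝ, 0 < vs ∧ vs < C ∧ asF C vs = 0 ∧
    asf C vs < 0 ∧ (∀ v, 0 < v → v < vs → 0 < asF C v) ∧
    (∀ v, vs < v → v < C → asF C v < 0) := by
  have hC0 : 0 < C := by linarith
  have hinv : 1 / C < 1 := by rw [div_lt_one hC0]; exact hC
  -- zero of g
  obtain ⟨v0, ⟨hv00, hv01⟩, hv0⟩ : ∃ v0 ∈ Set.Icc 0 (C - 1 / C), C - 1 / (C - v0) - v0 / 2 = 0 := by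
    have hcont : ContinuousOn (fun v : ℝ => C - 1 / (C - v) - v / 2) (Set.Icc 0 (C - 1 / C)) := by
      have : ∀ v ∈ Set.Icc 0 (C - 1 / C), C - v ≠ 0 := by
        rintro v ⟨_, h⟩
        have : 0 < 1 / C := by positivity
        linarith
      fun_prop (disch := assumption)
    have := intermediate_value_Icc' (by linarith) hcont
    apply this
    constructor
    · have : C - 1 / (C - (C - 1 / C)) - (C - 1 / C) / 2 = - ((C - 1 / C) / 2) := by
        field_simp; ring
      simp only [this]
      linarith
    · simp only [sub_zero, zero_div]
      linarith
  have hv0C : v0 < C := by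
    have : 0 < 1 / C := by positivity
    linarith
  have hv0pos : 0 < v0 := by
    rcases hv00.eq_or_lt with h | h
    · rw [← h] at hv0
      simp only [sub_zero, zero_div] at hv0
      linarith
    · exact h
  have hmono : StrictMonoOn (asF C) (Set.Icc 0 v0) := by
    apply strictMonoOn_of_deriv_pos (convex_Icc _ _)
    · intro v hv
      exact (asF_hasDerivAt hC (by linarith [hv.2])).continuousAt.continuousWithinAt
    · intro v hv
      rw [interior_Icc] at hv
      rw [(asF_hasDerivAt hC (by linarith [hv.2])).deriv, asf_eq]
      have := as_g_anti hv.2 hv0C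
      exact mul_pos hv.1 (by linarith)
  have hanti : StrictAntiOn (asF C) (Set.Ico v0 C) := by
    apply strictAntiOn_of_deriv_neg (convex_Ico _ _)
    · intro v hv
      exact (asF_hasDerivAt hC hv.2).continuousAt.continuousWithinAt
    · intro v hv
      rw [interior_Ico] at hv
      rw [(asF_hasDerivAt hC hv.2).deriv, asf_eq]
      have := as_g_anti hv.1 hv.2
      exact mul_neg_of_pos_of_neg (by linarith [hv.1]) (by linarith)
  have hpos : ∀ v, 0 < v → v ≤ v0 → 0 < asF C v := by
    intro v h1 h2
    have := hmono ⟨le_refl _, hv0pos.le⟩ ⟨h1.le, h2⟩ h1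
    rwa [asF_zero] at this
  -- a negative value
  obtain ⟨w, hw0, hwC, hw⟩ : ∃ w, 0 < w ∧ w < C ∧ asF C w < 0 := by
    have he := Real.exp_pos (-(C ^ 2 + 1))
    have he1 : Real.exp (-(C ^ 2 + 1)) < 1 := by
      rw [Real.exp_lt_one_iff]; nlinarith
    have hw0 : 0 < C * (1 - Real.exp (-(C ^ 2 + 1))) := mul_pos hC0 (by linarith)
    have hwC : C * (1 - Real.exp (-(C ^ 2 + 1))) < C := by nlinarith
    refine ⟨C * (1 - Real.exp (-(C ^ 2 + 1))), hw0, hwC, ?_⟩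
    have hlog : Real.log (1 - C * (1 - Real.exp (-(C ^ 2 + 1))) / C) = -(C ^ 2 + 1) := by
      rw [mul_div_cancel_left₀ _ hC0.ne', sub_sub_cancel, Real.log_exp]
    unfold asF
    rw [hlog]
    set w := C * (1 - Real.exp (-(C ^ 2 + 1)))
    have h3 : 0 < w ^ 3 := by positivity
    have h2 : C * w ^ 2 ≤ C * C ^ 2 := by gcongr
    have h4 : 0 < C * C ^ 2 := by positivity
    nlinarith
  have hv0w : v0 < w := by
    by_contra h
    push Not at h
    linarith [hpos w hw0 h]
  obtain ⟨vs, ⟨hs1, hs2⟩, hs⟩ : ∃ vs ∈ Set.Icc v0 w, asF C vs = 0 := by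
    have hcont : ContinuousOn (asF C) (Set.Icc v0 w) := fun v hv =>
      (asF_hasDerivAt hC (by linarith [hv.2])).continuousAt.continuousWithinAt
    exact intermediate_value_Icc' hv0w.le hcont ⟨hw.le, (hpos v0 hv0pos le_rfl).le⟩
  have hvs : v0 < vs := by
    rcases hs1.eq_or_lt with h | h
    · have := hpos v0 hv0pos le_rfl
      rw [h] at this; linarith
    · exact h
  refine ⟨vs, by linarith, by linarith, hs, ?_, ?_, ?_⟩
  · rw [asf_eq]
    have := as_g_anti hvs (by linarith : vs < C)
    exact mul_neg_of_pos_of_neg (by linarith) (by linarith)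
  · intro v h1 h2
    rcases le_or_gt v v0 with h | h
    · exact hpos v h1 h
    · have := hanti ⟨h.le, by linarith⟩ ⟨hvs.le, by linarith⟩ h2
      linarith
  · intro v h1 h2
    have := hanti ⟨hvs.le, by linarith⟩ ⟨by linarith, h2⟩ h1
    linarith

/-- Autonomous scalar ODE with even, positive, bounded continuous right-hand side. -/
lemma as_scalar_ode (p : ℝ → ℝ) (hp : Continuous p) (hpos : ∀ s, 0 < p s) (heven : ∀ s, p (-s) = p s)
    (M : ℝ) (hM : ∀ s, p s ≤ M) :
    ∃ σ : ℝ → ℝ, (∀ x, HasDerivAt σ (p (σ x)) x) ∧ (∀ x, σ (-x) = - σ x) ∧ StrictMono σ ∧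
      Tendsto σ atTop atTop := by
  have hM0 : 0 < M := (hpos 0).trans_le (hM 0)
  have hc : Continuous (fun s => (p s)⁻¹) := hp.inv₀ (fun s => (hpos s).ne')
  set X : ℝ → ℝ := fun s => ∫ t in (0:ℝ)..s, (p t)⁻¹ with hX
  have hd : ∀ s, HasDerivAt X (p s)⁻¹ s := fun s =>
    (hc.integral_hasStrictDerivAt 0 s).hasDerivAt
  have hmono : StrictMono X := strictMono_of_deriv_pos (fun s => by
    rw [(hd s).deriv]; exact inv_pos.2 (hpos s))
  have hodd : ∀ s, X (-s) = - X s := by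
    intro s
    have := intervalIntegral.integral_comp_neg (a := 0) (b := s) (fun t => (p t)⁻¹)
    simp only [heven, neg_zero] at this
    simp only [hX]
    rw [this, intervalIntegral.integral_symm]
  have hXc : Continuous X := continuous_iff_continuousAt.2 fun s => (hd s).continuousAt
  have hmono2 : Monotone (fun s => X s - M⁻¹ * s) := by
    have hd2 : ∀ s, HasDerivAt (fun s => X s - M⁻¹ * s) ((p s)⁻¹ - M⁻¹ * 1) s := fun s =>
      (hd s).sub ((hasDerivAt_id s).const_mul _)
    apply monotone_of_deriv_nonneg (fun s => (hd2 s).differentiableAt)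
    intro s
    rw [(hd2 s).deriv]
    have := inv_anti₀ (hpos s) (hM s)
    linarith
  have h0 : X 0 = 0 := by simp [hX]
  have htop : Tendsto X atTop atTop := by
    apply tendsto_atTop_mono' atTop (f₁ := fun s => M⁻¹ * s)
    · filter_upwards [eventually_ge_atTop 0] with s hs
      have := hmono2 hs
      simp only [h0] at this
      linarith
    · exact tendsto_id.const_mul_atTop (inv_pos.2 hM0)
  have hbot : Tendsto X atBot atBot := by
    have : X = fun s => - X (-s) := by funext s; rw [hodd]; ring
    rw [this]
    exact tendsto_neg_atTop_atBot.comp (htop.comp tendsto_neg_atBot_atTop)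
  have hsurj := hXc.surjective htop hbot
  let e := StrictMono.orderIsoOfSurjective X hmono hsurj
  have he : ∀ s, e s = X s := fun s => rfl
  have hXe : ∀ x, X (e.symm x) = x := fun x => by rw [← he]; exact e.apply_symm_apply x
  refine ⟨e.symm, ?_, ?_, e.symm.strictMono, e.symm.tendsto_atTop⟩
  · intro x
    have := HasDerivAt.of_local_left_inverse (f := X) (g := e.symm) (a := x)
      e.symm.continuous.continuousAt (hd _) (inv_pos.2 (hpos _)).ne'
      (Eventually.of_forall hXe)
    simpa using this
  · intro x
    apply hmono.injective
    rw [hXe, hodd, hXe]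

/-- Abstract form of the existence construction: `V` and its derivative `W`. -/
lemma as_exists_VW {C vs : ℝ} (hC : 1 < C) (h0 : 0 < vs) (hvC : vs < C) (hF : asF C vs = 0)
    (hf : asf C vs < 0) (hpos : ∀ v, 0 < v → v < vs → 0 < asF C v) :
    ∃ V W : ℝ → ℝ, (∀ x, HasDerivAt V (W x) x) ∧ Continuous W ∧ (∀ x, V (-x) = V x) ∧
      (∀ x, 0 < V x ∧ V x ≤ vs) ∧ StrictAntiOn V (Set.Ioi 0) ∧ Tendsto V atTop (nhds 0) ∧
      (∀ x, W x ^ 2 = 2 / C * asF C (V x)) ∧ (∀ x, 0 < x → W x < 0) ∧ (∀ x, x < 0 → 0 < W x) := by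
  have hC0 : 0 < C := by linarith
  set G : ℝ → ℝ := fun v => - dslope (asF C) vs v with hG
  have hGF : ∀ v, asF C v = (vs - v) * G v := by
    intro v
    have := sub_smul_dslope (asF C) vs v
    rw [hF, smul_eq_mul] at this
    simp only [hG]
    linarith
  have hGc : ∀ v, v < C → ContinuousAt G v := by
    intro v hv
    apply ContinuousAt.neg
    rcases eq_or_ne v vs with h | h
    · rw [h]
      exact continuousAt_dslope_same.2 (asF_hasDerivAt hC hvC).differentiableAt
    · exact (continuousAt_dslope_of_ne h).2 (asF_hasDerivAt hC hv).continuousAt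
  have hGpos : ∀ v, 0 < v → v ≤ vs → 0 < G v := by
    intro v h1 h2
    rcases h2.eq_or_lt with h | h
    · simp only [hG, h, dslope_same, (asF_hasDerivAt hC hvC).deriv]
      linarith
    · have := hpos v h1 h
      rw [hGF] at this
      exact pos_of_mul_pos_right this (by linarith)
  obtain ⟨K, hK0, hK⟩ : ∃ K, 0 ≤ K ∧ ∀ v, 0 < v → v ≤ vs → G v ≤ K * v ^ 2 := by
    obtain ⟨K1, hK1⟩ := (isCompact_Icc (a := vs / 2) (b := vs)).exists_bound_of_continuousOn
      (f := G) (fun v hv => (hGc v (by linarith [hv.2])).continuousWithinAt)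
    refine ⟨C / vs + 4 * |K1| / vs ^ 2, by positivity, ?_⟩
    intro v h1 h2
    have hA : 0 ≤ C / vs * v ^ 2 := by positivity
    have hB : 0 ≤ 4 * |K1| / vs ^ 2 * v ^ 2 := by positivity
    rw [add_mul]
    rcases le_or_gt (vs / 2) v with h | h
    · have h3 := (le_abs_self _).trans (hK1 v ⟨h, h2⟩)
      have h4 : |K1| ≤ 4 * |K1| / vs ^ 2 * v ^ 2 := by
        have : 4 * |K1| / vs ^ 2 * v ^ 2 = |K1| * (4 * v ^ 2 / vs ^ 2) := by ring
        rw [this]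
        apply le_mul_of_one_le_right (abs_nonneg _)
        rw [le_div_iff₀ (by positivity)]
        nlinarith
      linarith [le_abs_self K1]
    · have h3 := asF_le hC h1.le (by linarith : v < C)
      rw [hGF] at h3
      have h4 : vs / 2 * G v ≤ (vs - v) * G v :=
        mul_le_mul_of_nonneg_right (by linarith) (hGpos v h1 h2).le
      have h5 : G v ≤ C / vs * v ^ 2 := by
        rw [div_mul_eq_mul_div, le_div_iff₀ h0]
        linarith
      linarith
  set φ : ℝ → ℝ := fun s => vs / Real.cosh s ^ 2 with hφ
  have hch : ∀ s, 0 < Real.cosh s := Real.cosh_pos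
  have hφpos : ∀ s, 0 < φ s := fun s => by have := hch s; simp only [hφ]; positivity
  have hφle : ∀ s, φ s ≤ vs := fun s => by
    apply div_le_self h0.le
    nlinarith [Real.one_le_cosh s]
  have hφd : ∀ s, HasDerivAt φ (-2 * φ s * (Real.sinh s / Real.cosh s)) s := by
    intro s
    have h1 := (hasDerivAt_const s vs).div ((Real.hasDerivAt_cosh s).pow 2)
      (pow_ne_zero 2 (hch s).ne')
    refine h1.congr_deriv ?_
    have := (hch s).ne'
    simp only [hφ]
    field_simp
    push_cast
    simp
    ring
  have hφc : Continuous φ := continuous_iff_continuousAt.2 fun s => (hφd s).continuousAt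
  set r : ℝ → ℝ := fun s => Real.sqrt (vs * G (φ s) / (2 * C)) with hr
  have hrpos : ∀ s, 0 < r s := fun s => by
    have := hGpos _ (hφpos s) (hφle s)
    exact Real.sqrt_pos.2 (by positivity)
  have hrc : Continuous r := by
    apply Real.continuous_sqrt.comp
    have : Continuous (fun s => G (φ s)) := continuous_iff_continuousAt.2 fun s =>
      ContinuousAt.comp (g := G) (hGc _ ((hφle s).trans_lt hvC)) hφc.continuousAt
    exact (continuous_const.mul this).div_const _
  have hφe : ∀ s, φ (-s) = φ s := fun s => by simp [hφ, Real.cosh_neg]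
  obtain ⟨σ, hσd, hσo, hσm, hσt⟩ := as_scalar_ode (fun s => r s / φ s)
    (hrc.div hφc fun s => (hφpos s).ne') (fun s => div_pos (hrpos s) (hφpos s))
    (fun s => by simp only [hr, hφe]) (Real.sqrt (vs * K / (2 * C))) (fun s => by
      rw [div_le_iff₀ (hφpos s)]
      have : Real.sqrt (vs * K / (2 * C)) * φ s = Real.sqrt (vs * K / (2 * C) * φ s ^ 2) := by
        rw [Real.sqrt_mul (by positivity), Real.sqrt_sq (hφpos s).le]
      rw [this]
      apply Real.sqrt_le_sqrt
      have := hK _ (hφpos s) (hφle s)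
      have h2 : vs * K / (2 * C) * φ s ^ 2 = vs * (K * φ s ^ 2) / (2 * C) := by ring
      rw [h2]
      gcongr)
  have hσ0 : σ 0 = 0 := by have := hσo 0; simp at this; linarith
  have hσc : Continuous σ := continuous_iff_continuousAt.2 fun s => (hσd s).continuousAt
  refine ⟨fun x => φ (σ x), fun x => -2 * (Real.sinh (σ x) / Real.cosh (σ x)) * r (σ x),
    ?_, ?_, ?_, ?_, ?_, ?_, ?_, ?_, ?_⟩
  · intro x
    refine ((hφd (σ x)).comp x (hσd x)).congr_deriv ?_
    have := (hφpos (σ x)).ne'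
    field_simp
  · have hs : Continuous fun x => Real.sinh (σ x) := Real.continuous_sinh.comp hσc
    have hc : Continuous fun x => Real.cosh (σ x) := Real.continuous_cosh.comp hσc
    exact (continuous_const.mul (hs.div hc fun x => (hch _).ne')).mul (hrc.comp hσc)
  · intro x
    simp only [hσo, hφe]
  · intro x
    exact ⟨hφpos _, hφle _⟩
  · intro x hx y hy hxy
    simp only [Set.mem_Ioi] at hx hy
    have h1 : 0 < σ x := by rw [← hσ0]; exact hσm hx
    have h2 := hσm hxy
    have h3 := Real.cosh_strictMonoOn (Set.mem_Ici.2 h1.le) (Set.mem_Ici.2 (h1.trans h2).le) h2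
    have := hch (σ x)
    simp only [hφ]
    gcongr
  · have hct : Tendsto (fun x => Real.cosh (σ x) ^ 2) atTop atTop := by
      apply tendsto_atTop_mono (f := σ) _ hσt
      intro x
      have h1 := Real.one_le_cosh (σ x)
      have h2 := Real.sinh_lt_cosh (σ x)
      have h3 := Real.cosh_sq (σ x)
      rcases le_or_gt 0 (σ x) with h | h
      · have := Real.self_le_sinh_iff.2 h
        nlinarith
      · nlinarith
    exact tendsto_const_nhds.div_atTop hct
  · intro x
    have hg := hGpos _ (hφpos (σ x)) (hφle (σ x))
    rw [mul_pow, mul_pow, Real.sq_sqrt (by positivity), hGF]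
    have h1 : vs - φ (σ x) = vs * (Real.sinh (σ x) / Real.cosh (σ x)) ^ 2 := by
      have := (hch (σ x)).ne'
      simp only [hφ]
      field_simp
      rw [Real.cosh_sq]; ring
    rw [h1]
    field_simp
  · intro x hx
    have h1 : 0 < σ x := by rw [← hσ0]; exact hσm hx
    have := div_pos (Real.sinh_pos_iff.2 h1) (hch (σ x))
    have := mul_pos this (hrpos (σ x))
    simp only
    linarith
  · intro x hx
    have h1 : σ x < 0 := by rw [← hσ0]; exact hσm hx
    have := div_neg_of_neg_of_pos (Real.sinh_neg_iff.2 h1) (hch (σ x))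
    have := mul_neg_of_neg_of_pos this (hrpos (σ x))
    simp only
    linarith

lemma asf_continuousAt {C v : ℝ} (hv : v < C) : ContinuousAt (asf C) v := by
  have : C - v ≠ 0 := by linarith
  unfold asf
  fun_prop (disch := assumption)

/-- The second derivative, from the energy identity. -/
lemma as_second {C vs : ℝ} (hC : 1 < C) (hvC : vs < C) {V W : ℝ → ℝ}
    (hV : ∀ x, HasDerivAt V (W x) x) (hW : Continuous W) (hb : ∀ x, 0 < V x ∧ V x ≤ vs)
    (hE : ∀ x, W x ^ 2 = 2 / C * asF C (V x)) (hn : ∀ x, 0 < x → W x < 0)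
    (hp : ∀ x, x < 0 → 0 < W x) : ∀ x, HasDerivAt W (asf C (V x) / C) x := by
  have hC0 : 0 < C := by linarith
  have hb' : ∀ x, V x < C := fun x => (hb x).2.trans_lt hvC
  have hFd : ∀ x, HasDerivAt (fun y => 2 / C * asF C (V y)) (2 / C * (asf C (V x) * W x)) x :=
    fun x => (HasDerivAt.comp x (asF_hasDerivAt hC (hb' x)) (hV x)).const_mul _
  have hne : ∀ x, x ≠ 0 → HasDerivAt W (asf C (V x) / C) x := by
    intro x hx
    have hWx : W x ≠ 0 := by
      rcases lt_or_gt_of_ne hx with h | h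
      · exact (hp x h).ne'
      · exact (hn x h).ne
    have hsq : 2 / C * asF C (V x) ≠ 0 := by rw [← hE]; exact pow_ne_zero 2 hWx
    have hs := (hFd x).sqrt hsq
    have habs : ∀ y, Real.sqrt (2 / C * asF C (V y)) = |W y| := fun y => by
      rw [← hE, Real.sqrt_sq_eq_abs]
    rw [habs x] at hs
    rcases lt_or_gt_of_ne hx with h | h
    · have : W =ᶠ[nhds x] fun y => Real.sqrt (2 / C * asF C (V y)) := by
        filter_upwards [Iio_mem_nhds h] with y hy
        rw [habs, abs_of_pos (hp y hy)]
      refine (hs.congr_of_eventuallyEq this).congr_deriv ?_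
      rw [abs_of_pos (hp x h)]
      field_simp
    · have : W =ᶠ[nhds x] fun y => - Real.sqrt (2 / C * asF C (V y)) := by
        filter_upwards [Ioi_mem_nhds h] with y hy
        rw [habs, abs_of_neg (hn y hy), neg_neg]
      refine (hs.neg.congr_of_eventuallyEq this).congr_deriv ?_
      rw [abs_of_neg (hn x h)]
      field_simp
  have hVc : Continuous V := continuous_iff_continuousAt.2 fun s => (hV s).continuousAt
  intro x
  rcases eq_or_ne x 0 with h | h
  · rw [h]
    refine hasDerivAt_of_hasDerivAt_of_ne (g := fun x => asf C (V x) / C) hne hW.continuousAt ?_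
    exact (ContinuousAt.comp (g := asf C) (asf_continuousAt (hb' 0)) hVc.continuousAt).div_const _
  · exact hne x h

/-- Consequences of the equation for an arbitrary profile. -/
lemma as_profile {C vs : ℝ} (hC : 1 < C) (h0 : 0 < vs) (hvC : vs < C)
    (hpos : ∀ v, 0 < v → v < vs → 0 < asF C v) (hneg : ∀ v, vs < v → v < C → asF C v < 0)
    {V : ℝ → ℝ} (hd : ContDiff ℝ 2 V) (he : ∀ x, V (-x) = V x) (hb : ∀ x, 0 < V x ∧ V x < C)
    (ht : Tendsto V atTop (nhds 0)) (ht' : Tendsto (deriv V) atTop (nhds 0))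
    (hode : ∀ x, C * deriv (deriv V) x = C * V x - V x / (C - V x) - (1 / 2) * (V x) ^ 2) :
    (∀ x, HasDerivAt (fun y => (V y, deriv V y)) (deriv V x, asf C (V x) / C) x) ∧
    (∀ x, (V x, deriv V x) ∈ Set.Icc 0 vs ×ˢ Set.Icc (-vs) vs) ∧
    (V 0, deriv V 0) = (vs, 0) := by
  have hC0 : 0 < C := by linarith
  have hd1 : ∀ x, HasDerivAt V (deriv V x) x := fun x =>
    ((hd.differentiable (by norm_num)) x).hasDerivAt
  have hdd : ContDiff ℝ 1 (deriv V) := by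
    have h : ContDiff ℝ (1 + 1) V := by simpa [one_add_one_eq_two] using hd
    exact (contDiff_succ_iff_deriv.1 h).2.2
  have hd2 : ∀ x, HasDerivAt (deriv V) (asf C (V x) / C) x := by
    intro x
    have h := ((hdd.differentiable (by norm_num)) x).hasDerivAt
    refine h.congr_deriv ?_
    rw [eq_div_iff hC0.ne', mul_comm, hode x, asf]
  set E : ℝ → ℝ := fun x => C / 2 * deriv V x ^ 2 - asF C (V x) with hE
  have hEd : ∀ x, HasDerivAt E 0 x := by
    intro x
    refine ((((hd2 x).pow 2).const_mul (C / 2)).sub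
      (HasDerivAt.comp x (asF_hasDerivAt hC (hb x).2) (hd1 x))).congr_deriv ?_
    push_cast
    field_simp
    simp
  have hEc : ∀ x, E x = E 0 := fun x =>
    is_const_of_deriv_eq_zero (fun x => (hEd x).differentiableAt) (fun x => (hEd x).deriv) x 0
  have hEt : Tendsto E atTop (nhds 0) := by
    have h1 : Tendsto (fun x => asF C (V x)) atTop (nhds (asF C 0)) :=
      (asF_hasDerivAt hC hC0).continuousAt.tendsto.comp ht
    have h2 := ((ht'.pow 2).const_mul (C / 2)).sub h1
    simpa [asF_zero] using h2
  have hE0 : E 0 = 0 := by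
    have h3 : E = fun _ => E 0 := funext hEc
    rw [h3] at hEt
    exact tendsto_nhds_unique tendsto_const_nhds hEt
  have hen : ∀ x, C / 2 * deriv V x ^ 2 = asF C (V x) := by
    intro x
    have := hEc x
    rw [hE0] at this
    simp only [hE] at this
    linarith
  have hle : ∀ x, V x ≤ vs := by
    intro x
    by_contra h
    push Not at h
    have h1 := hneg _ h (hb x).2
    rw [← hen x] at h1
    have : 0 ≤ C / 2 * deriv V x ^ 2 := by positivity
    linarith
  refine ⟨fun x => (hd1 x).prodMk (hd2 x), fun x => ?_, ?_⟩
  · have h1 := asF_le hC (hb x).1.le (hb x).2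
    rw [← hen x] at h1
    have h2 : deriv V x ^ 2 ≤ V x ^ 2 := by
      have : C / 2 * deriv V x ^ 2 ≤ C / 2 * V x ^ 2 := by linarith
      exact le_of_mul_le_mul_left this (by positivity)
    have h3 := abs_le.1 (abs_le_of_sq_le_sq h2 (hb x).1.le)
    have h4 := hle x
    exact ⟨⟨(hb x).1.le, h4⟩, ⟨by linarith [h3.1], by linarith [h3.2]⟩⟩
  · have hV0 : deriv V 0 = 0 := by
      have h1 : HasDerivAt (fun x => V (-x)) (- deriv V 0) 0 := by
        have := (hd1 (-0)).scomp (0 : ℝ) (hasDerivAt_neg 0)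
        simp only [neg_zero, smul_eq_mul, neg_mul, one_mul] at this
        exact this
      have h2 : (fun x => V (-x)) = V := funext he
      rw [h2] at h1
      have := h1.unique (hd1 0)
      linarith
    have h5 := hen 0
    rw [hV0] at h5
    have h6 : V 0 = vs := by
      rcases (hle 0).eq_or_lt with h | h
      · exact h
      · have := hpos _ (hb 0).1 h
        rw [← h5] at this
        simp at this
    rw [h6, hV0]

theorem amick_schonbek_solitary_wave_exists_unique
    (C : ℝ) (hC : 1 < C) :
    ∃! V : ℝ → ℝ,
      ContDiff ℝ 2 V ∧
      (∀ ξ : ℝ, V (-ξ) = V ξ) ∧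
      (∀ ξ : ℝ, 0 < V ξ ∧ V ξ < C) ∧
      StrictAntiOn V (Set.Ioi (0 : ℝ)) ∧
      Tendsto V atTop (nhds 0) ∧
      Tendsto (deriv V) atTop (nhds 0) ∧
      (∀ ξ : ℝ,
        C * deriv (deriv V) ξ
          = C * V ξ - V ξ / (C - V ξ) - (1 / 2) * (V ξ) ^ 2) := by
  have hC0 : 0 < C := by linarith
  obtain ⟨vs, h0, hvC, hF, hf, hpos, hneg⟩ := as_exists_vs hC
  apply existsUnique_of_exists_of_unique
  · obtain ⟨V, W, hV, hW, he, hb, hanti, ht, hE, hn, hp⟩ := as_exists_VW hC h0 hvC hF hf hpos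
    have hW2 := as_second hC hvC hV hW hb hE hn hp
    have hdV : deriv V = W := funext fun x => (hV x).deriv
    have hdW : deriv W = fun x => asf C (V x) / C := funext fun x => (hW2 x).deriv
    have hVc : Continuous V := continuous_iff_continuousAt.2 fun s => (hV s).continuousAt
    refine ⟨V, ?_, he, fun x => ⟨(hb x).1, (hb x).2.trans_lt hvC⟩, hanti, ht, ?_, ?_⟩
    · have h1 : ContDiff ℝ 1 W := by
        rw [contDiff_one_iff_deriv, hdW]
        refine ⟨fun x => (hW2 x).differentiableAt, ?_⟩
        apply Continuous.div_const
        exact continuous_iff_continuousAt.2 fun x => ContinuousAt.comp (g := asf C)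
          (asf_continuousAt ((hb x).2.trans_lt hvC)) hVc.continuousAt
      have h2 : ContDiff ℝ (1 + 1) V := by
        rw [contDiff_succ_iff_deriv, hdV]
        exact ⟨fun x => (hV x).differentiableAt, by simp, h1⟩
      simpa [one_add_one_eq_two] using h2
    · rw [hdV]
      have h1 : Tendsto (fun x => W x ^ 2) atTop (nhds 0) := by
        have h1 : Tendsto (fun x => asF C (V x)) atTop (nhds (asF C 0)) :=
          (asF_hasDerivAt hC hC0).continuousAt.tendsto.comp ht
        have h2 := h1.const_mul (2 / C)
        rw [asF_zero, mul_zero] at h2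
        exact h2.congr fun x => (hE x).symm
      have h2 := (Real.continuous_sqrt.tendsto 0).comp h1
      rw [Real.sqrt_zero] at h2
      apply (tendsto_zero_iff_abs_tendsto_zero _).2
      exact h2.congr fun x => Real.sqrt_sq_eq_abs _
    · intro x
      rw [hdV, hdW]
      simp only [asf]
      field_simp
  · rintro V U ⟨a1, a2, a3, -, a5, a6, a7⟩ ⟨b1, b2, b3, -, b5, b6, b7⟩
    obtain ⟨hV1, hV2, hV3⟩ := as_profile hC h0 hvC hpos hneg a1 a2 a3 a5 a6 a7
    obtain ⟨hU1, hU2, hU3⟩ := as_profile hC h0 hvC hpos hneg b1 b2 b3 b5 b6 b7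
    obtain ⟨K, hK⟩ : ∃ K, LipschitzOnWith K (fun z : ℝ × ℝ => (z.2, asf C z.1 / C))
        (Set.Icc 0 vs ×ˢ Set.Icc (-vs) vs) := by
      apply ContDiffOn.exists_lipschitzOnWith (n := 1) _ (by norm_num)
        ((convex_Icc _ _).prod (convex_Icc _ _)) (isCompact_Icc.prod isCompact_Icc)
      have : ∀ z ∈ (Set.Icc 0 vs ×ˢ Set.Icc (-vs) vs : Set (ℝ × ℝ)), C - z.1 ≠ 0 := by
        rintro z ⟨⟨_, h⟩, _⟩
        linarith
      unfold asf
      fun_prop (disch := assumption)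
    have := ODE_solution_unique_univ (v := fun _ z => (z.2, asf C z.1 / C))
      (s := fun _ => Set.Icc 0 vs ×ˢ Set.Icc (-vs) vs) (t₀ := 0) (fun _ => hK)
      (fun t => ⟨hV1 t, hV2 t⟩) (fun t => ⟨hU1 t, hU2 t⟩) (by rw [hV3, hU3])
    funext x
    exact congrArg Prod.fst (congrFun this x)
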